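/- Let n = 2ν be even and J₀ the canonical antisymmetric matrix of order n. Let P, Q ∈ 𝕊₂ₙ be symmetric 2n×2n matrices and R ∈ 𝕊ₙ a symmetric n×n matrix. Let Δ := [[0, 0],[0, J₀R]] be the block 2n×2n matrix whose only nonzero block is the lower-right block J₀R. Then ⟨Q, ΔP + PΔᵀ⟩ = 2⟨𝐇(H²²), J₀R⟩, where H²² is the lower-right n×n block of H := QP and 𝐇(N) := (N + J₀NᵀJ₀)/2. In particular, if 𝐇(H²²) = 0 then ⟨Q, ΔP + PΔᵀ⟩ = 0 for every symmetric R. -/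

import Mathlib

open Matrix
open scoped Kronecker

/-- Index type for matrices of even order `n = 2ν`. -/
abbrev Idx (ν : ℕ) := Fin ν × Fin 2

/-- The canonical antisymmetric matrix `J₀ = I_ν ⊗ [[0,1],[-1,0]]` of order `n = 2ν`. -/
noncomputable def J0 (ν : ℕ) : Matrix (Idx ν) (Idx ν) ℝ :=
  (1 : Matrix (Fin ν) (Fin ν) ℝ) ⊗ₖ !![(0 : ℝ), 1; -1, 0]

/-- The map `𝐇(N) := (N + J₀ Nᵀ J₀)/2`. -/
noncomputable def Hproj (ν : ℕ) (N : Matrix (Idx ν) (Idx ν) ℝ) :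
    Matrix (Idx ν) (Idx ν) ℝ :=
  (1 / 2 : ℝ) • (N + J0 ν * Nᵀ * J0 ν)

theorem J0_transpose (ν : ℕ) : (J0 ν)ᵀ = -J0 ν := by
  have h : (!![(0 : ℝ), 1; -1, 0])ᵀ = -!![(0 : ℝ), 1; -1, 0] := by
    ext i j
    fin_cases i <;> fin_cases j <;> simp
  rw [J0, ← kroneckerMap_transpose, transpose_one, h]
  ext i j
  simp only [kroneckerMap_apply, Matrix.neg_apply, mul_neg]

theorem J0_mul_J0 (ν : ℕ) : J0 ν * J0 ν = -1 := by
  have h : !![(0 : ℝ), 1; -1, 0] * !![(0 : ℝ), 1; -1, 0] = -1 := by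
    ext i j
    fin_cases i <;> fin_cases j <;> simp
  rw [J0, ← mul_kronecker_mul, one_mul, h, ← one_kronecker_one]
  ext i j
  simp only [kroneckerMap_apply, Matrix.neg_apply, mul_neg]

/-- Against a Hamiltonian matrix `J₀ R`, a matrix and its Hamiltonian part have the same Frobenius
inner product. -/
theorem trace_Hproj_transpose_mul (ν : ℕ) (N R : Matrix (Idx ν) (Idx ν) ℝ) (hR : Rᵀ = R) :
    ((Hproj ν N)ᵀ * (J0 ν * R)).trace = (Nᵀ * (J0 ν * R)).trace := by
  have h₁ : (J0 ν * Nᵀ * J0 ν)ᵀ * (J0 ν * R) = -(J0 ν * N * R) := by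
    calc (J0 ν * Nᵀ * J0 ν)ᵀ * (J0 ν * R) = J0 ν * N * (J0 ν * J0 ν) * R := by
          simp [transpose_mul, J0_transpose, Matrix.mul_assoc]
      _ = -(J0 ν * N * R) := by simp [J0_mul_J0]
  have h₂ : (Nᵀ * (J0 ν * R)).trace = -(J0 ν * N * R).trace := by
    rw [← trace_transpose, trace_mul_comm (J0 ν * N) R]
    simp [transpose_mul, J0_transpose, hR, Matrix.mul_assoc]
  rw [Hproj, transpose_smul, transpose_add, Matrix.smul_mul, Matrix.add_mul, h₁, trace_smul,
    trace_add, trace_neg, ← h₂, smul_eq_mul]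
  ring

/-- For symmetric `P` and `Q`, the Frobenius inner product of `Q` with `D P + P Dᵀ` is twice that
of `Q P` with `D`. -/
theorem trace_transpose_mul_add_mul_transpose {m : Type*} [Fintype m] (P Q D : Matrix m m ℝ)
    (hP : Pᵀ = P) (hQ : Qᵀ = Q) :
    (Qᵀ * (D * P + P * Dᵀ)).trace = 2 * ((Q * P)ᵀ * D).trace := by
  have h₁ : (Q * (D * P)).trace = ((Q * P)ᵀ * D).trace := by
    rw [transpose_mul, hP, hQ, ← Matrix.mul_assoc, trace_mul_comm, Matrix.mul_assoc]
  have h₂ : (Q * (P * Dᵀ)).trace = ((Q * P)ᵀ * D).trace := by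
    rw [← trace_transpose, trace_mul_comm (Q * P)ᵀ D]
    simp [transpose_mul, Matrix.mul_assoc]
  rw [hQ, Matrix.mul_add, trace_add, h₁, h₂]
  ring

theorem trace_transpose_mul_fromBlocks_zero {m : Type*} [Fintype m]
    (H : Matrix (m ⊕ m) (m ⊕ m) ℝ) (X : Matrix m m ℝ) :
    (Hᵀ * fromBlocks 0 0 0 X).trace = ((toBlocks₂₂ H)ᵀ * X).trace := by
  conv_lhs => rw [← fromBlocks_toBlocks H]
  simp [fromBlocks_transpose, fromBlocks_multiply, Matrix.trace]

theorem stmt_17 (ν : ℕ)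
    (P Q : Matrix (Idx ν ⊕ Idx ν) (Idx ν ⊕ Idx ν) ℝ)
    (hP : Pᵀ = P) (hQ : Qᵀ = Q)
    (R : Matrix (Idx ν) (Idx ν) ℝ) (hR : Rᵀ = R)
    (Δ : Matrix (Idx ν ⊕ Idx ν) (Idx ν ⊕ Idx ν) ℝ)
    (hΔ : Δ = fromBlocks 0 0 0 (J0 ν * R)) :
    (Qᵀ * (Δ * P + P * Δᵀ)).trace =
      2 * ((Hproj ν (toBlocks₂₂ (Q * P)))ᵀ * (J0 ν * R)).trace ∧
    (Hproj ν (toBlocks₂₂ (Q * P)) = 0 →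
      (Qᵀ * (Δ * P + P * Δᵀ)).trace = 0) := by
  have h : (Qᵀ * (Δ * P + P * Δᵀ)).trace =
      2 * ((Hproj ν (toBlocks₂₂ (Q * P)))ᵀ * (J0 ν * R)).trace := by
    rw [trace_transpose_mul_add_mul_transpose P Q Δ hP hQ, hΔ,
      trace_transpose_mul_fromBlocks_zero, trace_Hproj_transpose_mul ν _ R hR]
  exact ⟨h, fun h₀ => by rw [h, h₀]; simp⟩
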